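/- arXiv:2405.17556 — 2 statements merged into one kernel-verified Lean document; each statement's English description precedes it below -/
import Mathlib

section
/- Let n ≥ 1 and let (B_k)_{k∈ℕ} be a sequence of hyperrectangles B_k = [l^{(k)}, u^{(k)}] in ℝ^n such that for every k, B_{k+1} is obtained from B_k by bisecting B_k along a coordinate d of maximal edge length, i.e., there is d ∈ {1,…,n} with u^{(k)}_d − l^{(k)}_d = max_i (u^{(k)}_i − l^{(k)}_i) such that l^{(k+1)}_i = l^{(k)}_i and u^{(k+1)}_i = u^{(k)}_i for all i ≠ d, while [l^{(k+1)}_d, u^{(k+1)}_d] is either [l^{(k)}_d, (l^{(k)}_d + u^{(k)}_d)/2] or [(l^{(k)}_d + u^{(k)}_d)/2, u^{(k)}_d]. Then for every k, w(B_{k+n}) ≤ w(B_k)/2, and consequently w(B_k) converges to 0 as k → ∞. -/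
open Filter Topology

/-- The `LongestEdge` splitting heuristic: if each box `B (k+1) = [l (k+1), u (k+1)]`
is obtained from `B k = [l k, u k]` by bisecting along a coordinate of maximal edge
length, then the width `w k = ⨆ i, (u k i - l k i)` satisfies `w (k+n) ≤ w k / 2`
for every `k`, and consequently `w k → 0`. -/
theorem stmt_4 {n : ℕ} (hn : 1 ≤ n) (l u : ℕ → Fin n → ℝ)
    (hlu : ∀ k, l k ≤ u k)
    (hsplit : ∀ k, ∃ d : Fin n,
      (u k d - l k d = ⨆ i, (u k i - l k i)) ∧
      (∀ i, i ≠ d → l (k + 1) i = l k i ∧ u (k + 1) i = u k i) ∧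
      ((l (k + 1) d = l k d ∧ u (k + 1) d = (l k d + u k d) / 2) ∨
       (l (k + 1) d = (l k d + u k d) / 2 ∧ u (k + 1) d = u k d))) :
    (∀ k, (⨆ i, (u (k + n) i - l (k + n) i)) ≤ (⨆ i, (u k i - l k i)) / 2) ∧
    Tendsto (fun k => ⨆ i, (u k i - l k i)) atTop (𝓝 0) := by
  classical
  have : Nonempty (Fin n) := ⟨⟨0, hn⟩⟩
  obtain ⟨e, he⟩ : ∃ e : ℕ → Fin n → ℝ, ∀ k i, u k i - l k i = e k i :=
    ⟨fun k i => u k i - l k i, fun _ _ => rfl⟩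
  have h0 : ∀ k i, 0 ≤ e k i := fun k i => by
    rw [← he]; exact sub_nonneg.mpr (hlu k i)
  have hs : ∀ k, ∃ d : Fin n, e k d = (⨆ i, e k i) ∧
      (∀ i, i ≠ d → e (k + 1) i = e k i) ∧ e (k + 1) d = e k d / 2 := by
    intro k
    obtain ⟨d, h1, h2, h3⟩ := hsplit k
    refine ⟨d, ?_, ?_, ?_⟩
    · simpa only [he] using h1
    · intro i hi
      rw [← he, ← he, (h2 i hi).1, (h2 i hi).2]
    · rw [← he, ← he]
      rcases h3 with ⟨a, b⟩ | ⟨a, b⟩ <;> rw [a, b] <;> ring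
  simp only [he]
  clear hsplit hlu he
  have hle : ∀ k i, e k i ≤ ⨆ i, e k i := fun k i =>
    le_ciSup (Set.finite_range _).bddAbove i
  have hstep : ∀ k i, e (k + 1) i ≤ e k i := by
    intro k i
    obtain ⟨d, _, h2, h3⟩ := hs k
    by_cases hi : i = d
    · subst hi
      linarith [h0 k i]
    · exact (h2 i hi).le
  have hanti : Antitone (fun k => ⨆ i, e k i) :=
    antitone_nat_of_succ_le fun k => ciSup_le fun i => (hstep k i).trans (hle k i)
  have hhalf : ∀ k, (⨆ i, e (k + n) i) ≤ (⨆ i, e k i) / 2 := by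
    intro k
    have key : ∀ j, (Finset.univ.filter
        (fun i => (⨆ i, e k i) / 2 < e (k + j) i)).card ≤ n - j := by
      intro j
      induction j with
      | zero => exact (Finset.card_le_univ _).trans (by simp)
      | succ j ih =>
        obtain ⟨d, h1, h2, h3⟩ := hs (k + j)
        have hW : (⨆ i, e (k + j) i) ≤ ⨆ i, e k i := hanti (Nat.le_add_right k j)
        have hsub : Finset.univ.filter (fun i => (⨆ i, e k i) / 2 < e (k + (j + 1)) i) ⊆
            (Finset.univ.filter (fun i => (⨆ i, e k i) / 2 < e (k + j) i)).erase d := by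
          intro i hi
          rw [Finset.mem_filter, ← add_assoc] at hi
          rw [Finset.mem_erase, Finset.mem_filter]
          refine ⟨?_, Finset.mem_univ _, hi.2.trans_le (hstep _ _)⟩
          rintro rfl
          linarith [hi.2]
        have hc := Finset.card_le_card hsub
        by_cases hd : d ∈ Finset.univ.filter (fun i => (⨆ i, e k i) / 2 < e (k + j) i)
        · rw [Finset.card_erase_of_mem hd] at hc
          omega
        · have hemp : Finset.univ.filter (fun i => (⨆ i, e k i) / 2 < e (k + j) i) = ∅ := by
            rw [Finset.eq_empty_iff_forall_notMem]
            intro i hi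
            apply hd
            rw [Finset.mem_filter] at hi ⊢
            exact ⟨Finset.mem_univ _, by linarith [hi.2, hle (k + j) i]⟩
          rw [hemp, Finset.erase_empty, Finset.card_empty] at hc
          exact hc.trans (Nat.zero_le _)
    have hn' := key n
    rw [Nat.sub_self, Nat.le_zero, Finset.card_eq_zero,
      Finset.eq_empty_iff_forall_notMem] at hn'
    refine ciSup_le fun i => ?_
    by_contra hcon
    exact hn' i (by rw [Finset.mem_filter]; exact ⟨Finset.mem_univ _, not_le.mp hcon⟩)
  refine ⟨hhalf, ?_⟩
  have hnn : ∀ k, 0 ≤ ⨆ i, e k i := fun k => Real.iSup_nonneg (h0 k)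
  have hlim := tendsto_atTop_ciInf hanti ⟨0, by rintro _ ⟨k, rfl⟩; exact hnn k⟩
  have hL1 := ge_of_tendsto' hlim hnn
  have hL2 := le_of_tendsto_of_tendsto' (hlim.comp (tendsto_add_atTop_nat n))
    (hlim.div_const 2) hhalf
  have hL : (⨅ k, ⨆ i, e k i) = 0 := by linarith
  rwa [hL] at hlim
end

section
/- Let F be a map from hyperrectangles in ℝ^n to hyperrectangles in ℝ^m that is an inclusion isotonic interval extension of f : ℝ^n → ℝ^m and is Lipschitz in the sense that there exists L ∈ ℝ with w(F([l, u])) ≤ L · w([l, u]) for every hyperrectangle [l, u]. Let X = [l, u] be a hyperrectangle in ℝ^n and M ∈ ℕ, M ≥ 1. For i ∈ {1,…,n} and j ∈ {1,…,M} let X_{i,j} = [l_i + (j−1)(u_i − l_i)/M, l_i + j(u_i − l_i)/M], and define F^{(M)}(X) = ⋃_{j_1,…,j_n ∈ {1,…,M}} F(X_{1,j_1} × ⋯ × X_{n,j_n}). Then w(F^{(M)}(X)) − w(f(X)) ≤ 2 L w(X) / M, where for a bounded set S ⊆ ℝ^m, w(S) = max_{i∈{1,…,m}} (sup_{y∈S}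 y_i − inf_{y∈S} y_i). -/
/-- The width of a (bounded) subset `S ⊆ ℝ^m`: the maximum over the coordinates of
the difference between the supremum and infimum of that coordinate over `S`. -/
noncomputable def setWidth {m : ℕ} (S : Set (Fin m → ℝ)) : ℝ :=
  ⨆ i : Fin m, (sSup ((fun y => y i) '' S) - sInf ((fun y => y i) '' S))

/-- Theorem 6.1 of Moore, Kearfott and Cloud: for an inclusion isotonic Lipschitz
interval extension `F` of `f`, the width of the union of the interval evaluations of
`F` over the `M`-step uniform subdivision of a box `[l, u]` exceeds the width of the
exact range `f '' [l, u]` by at most `2 L w([l, u]) / M`. -/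
theorem stmt_6 {n m : ℕ}
    (F : (Fin n → ℝ) → (Fin n → ℝ) → (Fin m → ℝ) × (Fin m → ℝ))
    (f : (Fin n → ℝ) → Fin m → ℝ)
    (hext : ∀ x, F x x = (f x, f x))
    (hiso : ∀ l u l' u', l ≤ u → l' ≤ u' →
      Set.Icc l' u' ⊆ Set.Icc l u →
      Set.Icc (F l' u').1 (F l' u').2 ⊆ Set.Icc (F l u).1 (F l u).2)
    (L : ℝ)
    (hlip : ∀ l u : Fin n → ℝ, l ≤ u →
      (⨆ i : Fin m, ((F l u).2 i - (F l u).1 i)) ≤ L * (⨆ i : Fin n, (u i - l i)))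
    (l u : Fin n → ℝ) (hlu : l ≤ u) (M : ℕ) (hM : 1 ≤ M) :
    setWidth (⋃ j : Fin n → Fin M,
        Set.Icc
          (F (fun i => l i + ((j i : ℕ) : ℝ) * (u i - l i) / M)
             (fun i => l i + (((j i : ℕ) : ℝ) + 1) * (u i - l i) / M)).1
          (F (fun i => l i + ((j i : ℕ) : ℝ) * (u i - l i) / M)
             (fun i => l i + (((j i : ℕ) : ℝ) + 1) * (u i - l i) / M)).2)
      - setWidth (f '' Set.Icc l u)
      ≤ 2 * L * (⨆ i : Fin n, (u i - l i)) / M := by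
  have hM0 : (0 : ℝ) < M := by exact_mod_cast hM
  have hf : ∀ a b x : Fin n → ℝ, a ≤ x → x ≤ b →
      f x ∈ Set.Icc (F a b).1 (F a b).2 := by
    intro a b x hax hxb
    have h := hiso a b x x (hax.trans hxb) le_rfl (Set.Icc_subset_Icc hax hxb)
    rw [hext] at h
    exact h ⟨le_rfl, le_rfl⟩
  set W : ℝ := ⨆ i : Fin n, (u i - l i) with hW
  set A : (Fin n → Fin M) → Fin n → ℝ :=
    fun j i => l i + ((j i : ℕ) : ℝ) * (u i - l i) / M with hA
  set B : (Fin n → Fin M) → Fin n → ℝ :=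
    fun j i => l i + (((j i : ℕ) : ℝ) + 1) * (u i - l i) / M with hB
  have hAB : ∀ j, A j ≤ B j := by
    intro j i
    have hd : 0 ≤ u i - l i := sub_nonneg.2 (hlu i)
    simp only [hA, hB]
    gcongr
    linarith
  have hlA : ∀ j, l ≤ A j := by
    intro j i
    have hd : 0 ≤ u i - l i := sub_nonneg.2 (hlu i)
    simp only [hA]
    have : 0 ≤ ((j i : ℕ) : ℝ) * (u i - l i) / M := by positivity
    linarith
  have hAu : ∀ j, A j ≤ u := by
    intro j i
    have hd : 0 ≤ u i - l i := sub_nonneg.2 (hlu i)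
    simp only [hA]
    have hj : ((j i : ℕ) : ℝ) ≤ M := by exact_mod_cast (j i).2.le
    have : ((j i : ℕ) : ℝ) * (u i - l i) / M ≤ u i - l i := by
      rw [div_le_iff₀ hM0]
      nlinarith
    linarith
  have hw : ∀ j, (⨆ i : Fin n, (B j i - A j i)) = W / M := by
    intro j
    rw [hW, div_eq_mul_inv, Real.iSup_mul_of_nonneg (by positivity)]
    congr 1
    ext i
    simp only [hA, hB]
    ring
  have hK : ∀ j i, (F (A j) (B j)).2 i - (F (A j) (B j)).1 i ≤ L * W / M := by
    intro j i
    have h := hlip (A j) (B j) (hAB j)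
    rw [hw, ← mul_div_assoc] at h
    exact (le_ciSup (f := fun i => (F (A j) (B j)).2 i - (F (A j) (B j)).1 i)
      (Set.finite_range _).bddAbove i).trans h
  rcases Nat.eq_zero_or_pos m with hm | hm
  · subst hm
    have h := hlip l u hlu
    simp only [Real.iSup_of_isEmpty] at h
    simp only [setWidth, Real.iSup_of_isEmpty, sub_zero]
    rw [mul_assoc]
    positivity
  haveI : Nonempty (Fin m) := ⟨⟨0, hm⟩⟩
  have hTa : ∀ i, BddAbove ((fun y : Fin m → ℝ => y i) '' (f '' Set.Icc l u)) := by
    rintro i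
    refine ⟨(F l u).2 i, ?_⟩
    rintro _ ⟨_, ⟨x, hx, rfl⟩, rfl⟩
    exact (hf l u x hx.1 hx.2).2 i
  have hTb : ∀ i, BddBelow ((fun y : Fin m → ℝ => y i) '' (f '' Set.Icc l u)) := by
    rintro i
    refine ⟨(F l u).1 i, ?_⟩
    rintro _ ⟨_, ⟨x, hx, rfl⟩, rfl⟩
    exact (hf l u x hx.1 hx.2).1 i
  have j0 : Fin n → Fin M := fun _ => ⟨0, hM⟩
  have hne : (⋃ j, Set.Icc (F (A j) (B j)).1 (F (A j) (B j)).2).Nonempty :=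
    ⟨f (A j0), Set.mem_iUnion.2 ⟨j0, hf _ _ _ le_rfl (hAB j0)⟩⟩
  rw [sub_le_iff_le_add]
  change setWidth (⋃ j, Set.Icc (F (A j) (B j)).1 (F (A j) (B j)).2) ≤ _
  refine ciSup_le fun i => ?_
  have h1 : sSup ((fun y : Fin m → ℝ => y i) ''
      (⋃ j, Set.Icc (F (A j) (B j)).1 (F (A j) (B j)).2)) ≤
      sSup ((fun y : Fin m → ℝ => y i) '' (f '' Set.Icc l u)) + L * W / M := by
    apply csSup_le (hne.image _)
    rintro _ ⟨y, hy, rfl⟩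
    obtain ⟨j, hj⟩ := Set.mem_iUnion.1 hy
    have a1 := (hf (A j) (B j) (A j) le_rfl (hAB j)).1 i
    have a2 := hj.2 i
    have a3 := hK j i
    have a4 := le_csSup (hTa i) ⟨f (A j), ⟨A j, ⟨hlA j, hAu j⟩, rfl⟩, rfl⟩
    simp only at a4 ⊢
    linarith
  have h2 : sInf ((fun y : Fin m → ℝ => y i) '' (f '' Set.Icc l u)) - L * W / M ≤
      sInf ((fun y : Fin m → ℝ => y i) ''
      (⋃ j, Set.Icc (F (A j) (B j)).1 (F (A j) (B j)).2)) := by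
    apply le_csInf (hne.image _)
    rintro _ ⟨y, hy, rfl⟩
    obtain ⟨j, hj⟩ := Set.mem_iUnion.1 hy
    have a1 := (hf (A j) (B j) (A j) le_rfl (hAB j)).2 i
    have a2 := hj.1 i
    have a3 := hK j i
    have a4 := csInf_le (hTb i) ⟨f (A j), ⟨A j, ⟨hlA j, hAu j⟩, rfl⟩, rfl⟩
    simp only at a4 ⊢
    linarith
  have h3 : sSup ((fun y : Fin m → ℝ => y i) '' (f '' Set.Icc l u)) -
      sInf ((fun y : Fin m → ℝ => y i) '' (f '' Set.Icc l u)) ≤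
      setWidth (f '' Set.Icc l u) :=
    le_ciSup (f := fun i : Fin m => sSup ((fun y : Fin m → ℝ => y i) '' (f '' Set.Icc l u)) -
      sInf ((fun y : Fin m → ℝ => y i) '' (f '' Set.Icc l u)))
      (Set.finite_range _).bddAbove i
  have h4 : 2 * L * W / M = L * W / M + L * W / M := by ring
  rw [h4]
  linarith
end
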